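/- arXiv:1704.03504 — 6 statements merged into one kernel-verified Lean document; each statement's English description precedes it below -/
import Mathlib

section
/- Let p be a prime, let P ∈ p↑ with P > 1, let N ∈ P↑, and let S, T be integers with 0 ≤ S < N and 0 ≤ T < N. Set R = (S + T + 1)N + T + 1. Then τ_p(S, T) = 0 if and only if N² divides the binomial coefficient C( P·((N−1)/(P−1))·R , ((N−1)/(P−1))·R ). -/
/-- `τ_p(a, b)`: the number of carries occurring when `a` and `b` are added
in base `p`. -/
def carries (p a b : ℕ) : ℕ :=
  ((Finset.range (a + b + 1)).filter
    (fun i => p ^ (i + 1) ≤ a % p ^ (i + 1) + b % p ^ (i + 1))).card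

/-- Recursion for the digit sum: splitting off the last digit. -/
lemma digits_sum_mul_add {p : ℕ} (hp : 1 < p) (a d : ℕ) (hd : d < p) :
    (Nat.digits p (p * a + d)).sum = d + (Nat.digits p a).sum := by
  rcases Nat.eq_zero_or_pos (p * a + d) with h | h
  · obtain ⟨h1, rfl⟩ : p * a = 0 ∧ d = 0 := by omega
    have : a = 0 := by
      rcases Nat.mul_eq_zero.mp h1 with h | h <;> omega
    simp [this]
  · rw [Nat.digits_def' hp h, List.sum_cons, Nat.mul_add_mod, Nat.mod_eq_of_lt hd,
      Nat.mul_add_div (by omega), Nat.div_eq_of_lt hd, Nat.add_zero]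

/-- The digit sum is additive over a splitting into low and high digits. -/
lemma digits_sum_pow_mul_add {p : ℕ} (hp : 1 < p) (m r q : ℕ) (hq : q < p ^ m) :
    (Nat.digits p (p ^ m * r + q)).sum = (Nat.digits p q).sum + (Nat.digits p r).sum := by
  induction m generalizing q with
  | zero =>
    obtain rfl : q = 0 := by simpa using hq
    simp
  | succ m ih =>
    have hd : q % p < p := Nat.mod_lt _ (by omega)
    have hq' : q / p < p ^ m := Nat.div_lt_of_lt_mul (by rwa [← pow_succ'])
    have e1 : p ^ (m + 1) * r + q = p * (p ^ m * r + q / p) + q % p := by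
      conv_lhs => rw [← Nat.div_add_mod q p]
      ring
    have e2 : (Nat.digits p q).sum = q % p + (Nat.digits p (q / p)).sum := by
      conv_lhs => rw [← Nat.div_add_mod q p]
      exact digits_sum_mul_add hp _ _ hd
    rw [e1, digits_sum_mul_add hp _ _ hd, ih _ hq', e2, add_assoc]

/-- The digit sums of `q` and its complement to `p ^ m - 1` add up to `m * (p - 1)`. -/
lemma digits_sum_compl {p : ℕ} (hp : 1 < p) (m a b : ℕ) (hab : a + b + 1 = p ^ m) :
    (Nat.digits p a).sum + (Nat.digits p b).sum = m * (p - 1) := by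
  induction m generalizing a b with
  | zero =>
    obtain ⟨rfl, rfl⟩ : a = 0 ∧ b = 0 := by rw [pow_zero] at hab; omega
    simp
  | succ m ih =>
    have hd : a % p < p := Nat.mod_lt _ (by omega)
    have ha := Nat.div_add_mod a p
    set c := a / p
    set d := a % p
    have hc : c < p ^ m := by
      rw [pow_succ'] at hab
      exact Nat.lt_of_mul_lt_mul_left (a := p) (by omega)
    obtain ⟨e, he⟩ := Nat.exists_eq_add_of_lt hc
    have hb : b = p * e + (p - 1 - d) := by
      rw [pow_succ', he] at hab
      have : p * (c + e + 1) = p * c + p * e + p := by ring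
      omega
    have := ih c e he.symm
    rw [hb, ← ha, digits_sum_mul_add hp _ _ hd, digits_sum_mul_add hp _ _ (by omega),
      Nat.succ_mul]
    omega

/-- Kummer's theorem for `carries`. -/
lemma carries_eq_padicValNat_choose (p a b : ℕ) [Fact p.Prime] :
    carries p a b = padicValNat p ((b + a).choose a) := by
  rw [padicValNat_choose' (b := a + b + 2)
    ((Nat.log_le_self _ _).trans_lt (by omega)), carries]
  refine Finset.card_bij (fun i _ => i + 1) ?_ (fun _ _ _ _ h => by simpa using h) ?_
  · intro i hi
    simp only [Finset.mem_filter, Finset.mem_range, Finset.mem_Ico] at hi ⊢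
    exact ⟨by omega, hi.2⟩
  · intro j hj
    simp only [Finset.mem_filter, Finset.mem_range, Finset.mem_Ico] at hj ⊢
    obtain ⟨i, rfl⟩ := Nat.exists_eq_add_of_le' hj.1.1
    exact ⟨i, ⟨by omega, hj.2⟩, rfl⟩

lemma carries_eq_zero_iff {p : ℕ} (hp : p.Prime) (a b : ℕ) :
    carries p a b = 0 ↔
      (Nat.digits p a).sum + (Nat.digits p b).sum ≤ (Nat.digits p (a + b)).sum := by
  have : Fact p.Prime := ⟨hp⟩
  have h := sub_one_mul_padicValNat_choose_eq_sub_sum_digits' (p := p) (k := a) (n := b)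
  rw [← carries_eq_padicValNat_choose, add_comm b a] at h
  rw [← Nat.sub_eq_zero_iff_le, ← h, Nat.mul_eq_zero]
  have := hp.two_le
  omega

/-- The `p`-adic valuation of `C(p ^ k * a, a)` is governed by the digits of `(p ^ k - 1) * a`. -/
lemma sub_one_mul_padicValNat_choose_pow_mul {p : ℕ} [hp : Fact p.Prime] (k a : ℕ) :
    (p - 1) * padicValNat p ((p ^ k * a).choose a) = (Nat.digits p ((p ^ k - 1) * a)).sum := by
  have hpos : 0 < p ^ k := pow_pos hp.out.pos k
  have e : p ^ k * a = (p ^ k - 1) * a + a := by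
    rw [← Nat.succ_mul, Nat.succ_eq_add_one, Nat.sub_add_cancel hpos]
  have h := digits_sum_pow_mul_add hp.out.one_lt k a 0 hpos
  rw [add_zero, Nat.digits_zero, List.sum_nil, zero_add] at h
  have h' := sub_one_mul_padicValNat_choose_eq_sub_sum_digits' (p := p) (k := a)
    (n := (p ^ k - 1) * a)
  rw [← e, h] at h'
  rw [h', Nat.add_sub_cancel_left]

theorem stmt8 (p : ℕ) (hp : p.Prime) (P N : ℕ)
    (hPp : ∃ n : ℕ, P = p ^ n) (hP1 : 1 < P) (hNP : ∃ n : ℕ, N = P ^ n)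
    (S T : ℕ) (hS : S < N) (hT : T < N)
    (R : ℕ) (hR : R = (S + T + 1) * N + T + 1) :
    carries p S T = 0 ↔
      N ^ 2 ∣ Nat.choose (P * ((N - 1) / (P - 1)) * R) (((N - 1) / (P - 1)) * R) := by
  have : Fact p.Prime := ⟨hp⟩
  obtain ⟨k, hk⟩ := hPp
  obtain ⟨n, hn⟩ := hNP
  have hNm : N = p ^ (k * n) := by rw [hn, hk, pow_mul]
  have hK : (P - 1) * ((N - 1) / (P - 1)) = N - 1 := by
    refine Nat.mul_div_cancel' ?_
    rw [hn]
    simpa using Nat.sub_dvd_pow_sub_pow P 1 n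
  set K := (N - 1) / (P - 1)
  obtain ⟨s, hs⟩ := Nat.exists_eq_add_of_lt hS
  obtain ⟨t, ht⟩ := Nat.exists_eq_add_of_lt hT
  have hprod : (P - 1) * (K * R) = N * (N * (S + T) + s) + t := by
    rw [← mul_assoc, hK, hR]
    obtain ⟨M, hM⟩ := Nat.exists_eq_add_of_lt (Nat.zero_lt_of_lt hS)
    have hs' : s = M - S := by omega
    have ht' : t = M - T := by omega
    have h1 : S ≤ M := by omega
    have h2 : T ≤ M := by omega
    rw [hM, hs', ht']
    zify [h1, h2]
    push_cast
    ring
  have hval := sub_one_mul_padicValNat_choose_pow_mul (p := p) k (K * R)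
  rw [← hk, hprod, hNm, digits_sum_pow_mul_add hp.one_lt _ _ _ (by omega),
    digits_sum_pow_mul_add hp.one_lt _ _ _ (by omega), ← mul_assoc] at hval
  have hne : (P * K * R).choose (K * R) ≠ 0 := by
    refine (Nat.choose_pos ?_).ne'
    rw [mul_assoc]
    exact Nat.le_mul_of_pos_left _ (by omega)
  have h1 := digits_sum_compl hp.one_lt (k * n) S s (by omega)
  have h2 := digits_sum_compl hp.one_lt (k * n) T t (by omega)
  rw [carries_eq_zero_iff hp, hNm, ← pow_mul, padicValNat_dvd_iff_le hne,
    ← Nat.mul_le_mul_left_iff (n := k * n * 2) (Nat.sub_pos_of_lt hp.one_lt), hval]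
  have : (p - 1) * (k * n * 2) = 2 * (k * n * (p - 1)) := by ring
  omega
end

section
/- Let A, X ∈ ℤ. Then (A² − 4)X² + 4 is a perfect square (i.e., (A² − 4)X² + 4 ∈ □) if and only if X = u_m(A, 1) for some m ∈ ℤ. -/
/-- The Lucas sequence `u_n(A, 1)` for natural indices:
`u₀ = 0`, `u₁ = 1`, `u_{n+2} = A·u_{n+1} - u_n`. -/
def lucasU (A : ℤ) : ℕ → ℤ
  | 0 => 0
  | 1 => 1
  | n + 2 => A * lucasU A (n + 1) - lucasU A n

/-- The Lucas sequence `u_n(A, 1)` extended to integer indices via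
`u_{-n} = -u_n`, so that `u_{n-1} + u_{n+1} = A·u_n` for all `n ∈ ℤ`. -/
def lucasUZ (A : ℤ) (n : ℤ) : ℤ :=
  if 0 ≤ n then lucasU A n.toNat else -(lucasU A (-n).toNat)

theorem exists_eq_lucasUZ_iff (A X : ℤ) :
    (∃ m : ℤ, X = lucasUZ A m) ↔ ∃ n : ℕ, X = lucasU A n ∨ X = -lucasU A n := by
  constructor
  · rintro ⟨m, rfl⟩
    unfold lucasUZ
    split_ifs
    · exact ⟨m.toNat, Or.inl rfl⟩
    · exact ⟨(-m).toNat, Or.inr rfl⟩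
  · rintro ⟨n, h | h⟩
    · exact ⟨n, by simp [lucasUZ, h]⟩
    · rcases Nat.eq_zero_or_pos n with rfl | hn
      · exact ⟨0, by simpa [lucasUZ, lucasU] using h⟩
      · refine ⟨-n, ?_⟩
        have hneg : ¬ (0 : ℤ) ≤ -n := by omega
        rw [lucasUZ, if_neg hneg, neg_neg, Int.toNat_natCast, h]

theorem lucasU_consecutive (A : ℤ) (n : ℕ) :
    lucasU A n ^ 2 - A * lucasU A n * lucasU A (n + 1) + lucasU A (n + 1) ^ 2 = 1 := by
  induction n with
  | zero => simp [lucasU]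
  | succ n ih =>
    rw [show lucasU A (n + 1 + 1) = A * lucasU A (n + 1) - lucasU A n from rfl]
    linear_combination ih

theorem lucasU_neg (A : ℤ) (n : ℕ) : lucasU (-A) n = (-1) ^ (n + 1) * lucasU A n := by
  induction n using Nat.twoStepInduction with
  | zero => simp [lucasU]
  | one => simp [lucasU]
  | more n ih₁ ih₂ =>
    simp only [lucasU, ih₁, ih₂]
    ring

theorem exists_lucasU_of_consecutive {A : ℤ} (n : ℕ) {x y : ℤ} (hn : x ≤ n)
    (hx : 0 ≤ x) (hxy : x ≤ y) (h : x ^ 2 - A * x * y + y ^ 2 = 1) :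
    ∃ k : ℕ, x = lucasU A k ∧ y = lucasU A (k + 1) := by
  induction n generalizing x y with
  | zero =>
    obtain rfl : x = 0 := by push_cast at hn; omega
    exact ⟨0, rfl, by simp only [lucasU]; nlinarith⟩
  | succ n ih =>
    rcases hx.eq_or_lt with rfl | hx
    · exact ih (by positivity) le_rfl hxy h
    have hprod : y * (A * x - y) = x ^ 2 - 1 := by linear_combination -h
    have hnonneg : 0 ≤ A * x - y := by
      by_contra! hlt
      nlinarith
    have hlt : A * x - y < x := by
      by_contra! hle
      nlinarith
    obtain ⟨k, hk, hk'⟩ := ih (x := A * x - y) (y := x) (by push_cast at hn; omega) hnonneg hlt.le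
      (by linear_combination h)
    refine ⟨k + 1, hk', ?_⟩
    simp only [lucasU]
    rw [← hk, ← hk']
    ring

theorem exists_lucasU_eq_of_sq {A X m : ℤ} (hA : 2 ≤ A) (hX : 0 ≤ X) (hm : 0 ≤ m)
    (h : (A ^ 2 - 4) * X ^ 2 + 4 = m ^ 2) : ∃ n : ℕ, X = lucasU A n := by
  have heven : Even (A * X + m) := by
    have hsq : Even (m ^ 2 - (A * X) ^ 2) := ⟨2 - 2 * X ^ 2, by linear_combination -h⟩
    simp only [Int.even_sub, Int.even_pow, Int.even_add] at hsq ⊢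
    tauto
  obtain ⟨y, hy⟩ := heven
  have hXy : X ≤ y := by nlinarith
  have hmy : m = 2 * y - A * X := by linarith
  subst hmy
  obtain ⟨k, hk, -⟩ := exists_lucasU_of_consecutive X.toNat (by omega) hX hXy
    (show X ^ 2 - A * X * y + y ^ 2 = 1 by linarith)
  exact ⟨k, hk⟩

theorem exists_lucasU_eq_or_neg_of_sq {A X m : ℤ} (h : (A ^ 2 - 4) * X ^ 2 + 4 = m ^ 2) :
    ∃ n : ℕ, X = lucasU A n ∨ X = -lucasU A n := by
  have habs : (|A| ^ 2 - 4) * |X| ^ 2 + 4 = |m| ^ 2 := by simpa only [sq_abs] using h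
  rcases le_or_gt 2 |A| with hA | hA
  · obtain ⟨n, hn⟩ := exists_lucasU_eq_of_sq hA (abs_nonneg X) (abs_nonneg m) habs
    refine ⟨n, ?_⟩
    rw [← abs_eq_abs, ← abs_abs X, hn]
    rcases abs_choice A with hA' | hA' <;> rw [hA']
    rw [lucasU_neg]
    simp [abs_mul]
  · have hA2 : A ^ 2 ≤ 1 := by
      rw [← sq_abs]
      nlinarith [abs_nonneg A]
    have hlower : -1 ≤ X := by nlinarith [sq_nonneg m]
    have hupper : X ≤ 1 := by nlinarith [sq_nonneg m]
    interval_cases X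
    · exact ⟨1, Or.inr rfl⟩
    · exact ⟨0, Or.inl rfl⟩
    · exact ⟨1, Or.inl rfl⟩

theorem stmt11 (A X : ℤ) :
    (∃ m : ℤ, (A ^ 2 - 4) * X ^ 2 + 4 = m ^ 2) ↔ ∃ m : ℤ, X = lucasUZ A m := by
  rw [exists_eq_lucasUZ_iff]
  constructor
  · rintro ⟨m, h⟩
    exact exists_lucasU_eq_or_neg_of_sq h
  · rintro ⟨n, hn⟩
    have hsq : X ^ 2 = lucasU A n ^ 2 := sq_eq_sq_iff_eq_or_eq_neg.mpr hn
    refine ⟨2 * lucasU A (n + 1) - A * lucasU A n, ?_⟩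
    rw [hsq]
    linear_combination -4 * lucasU_consecutive A n
end

section
/- Let A, B, C ∈ ℤ with 1 < |B| < |A|/2 − 1. Then C = u_B(A, 1) if and only if (A − 2) divides (C − B) and there exist an integer x ≠ 0 and an integer y such that D·F·I ∈ □, where D, E, F, G, H, I are defined from A, B, C, x, y as in the context. -/
/-- The product `D·F·I` built from `A, B, C, x, y` as in [S92, Theorem 1]:
`D = (A²-4)C²+4`, `E = C²Dx`, `F = 4(A²-4)E²+1`,
`G = 1+CDF-2(A+2)(A-2)²E²`, `H = C+BF+(2y-1)CF`, `I = (G²-1)H²+1`. -/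
def DFI (A B C x y : ℤ) : ℤ :=
  let D := (A ^ 2 - 4) * C ^ 2 + 4
  let E := C ^ 2 * D * x
  let F := 4 * (A ^ 2 - 4) * E ^ 2 + 1
  let G := 1 + C * D * F - 2 * (A + 2) * (A - 2) ^ 2 * E ^ 2
  let H := C + B * F + (2 * y - 1) * C * F
  let I := (G ^ 2 - 1) * H ^ 2 + 1
  D * F * I

theorem lucasUZ_natCast (A : ℤ) (n : ℕ) : lucasUZ A n = lucasU A n := by
  simp [lucasUZ]

@[simp] theorem lucasUZ_zero (A : ℤ) : lucasUZ A 0 = 0 := by simp [lucasUZ, lucasU]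

@[simp] theorem lucasUZ_one (A : ℤ) : lucasUZ A 1 = 1 := by simp [lucasUZ, lucasU]

theorem lucasUZ_neg (A n : ℤ) : lucasUZ A (-n) = -lucasUZ A n := by
  rcases lt_trichotomy n 0 with h | rfl | h
  · simp [lucasUZ, h.le, not_le.mpr h]
  · simp
  · simp [lucasUZ, h.le, not_le.mpr h]

theorem lucasUZ_succ (A n : ℤ) : lucasUZ A (n + 1) = A * lucasUZ A n - lucasUZ A (n - 1) := by
  have key (k : ℕ) :
      lucasUZ A (k + 1 + 1 : ℤ) = A * lucasUZ A (k + 1 : ℤ) - lucasUZ A (k : ℤ) := by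
    have h1 := lucasUZ_natCast A (k + 1)
    have h2 := lucasUZ_natCast A (k + 2)
    push_cast at h1 h2
    rw [show (k + 1 + 1 : ℤ) = k + 2 by ring, h1, h2, lucasUZ_natCast, lucasU]
  rcases lt_trichotomy n 0 with h | rfl | h
  · obtain ⟨k, hk⟩ := Int.eq_ofNat_of_zero_le (show 0 ≤ -n - 1 by omega)
    have := key k
    rw [show n + 1 = -(k : ℤ) by omega, show n - 1 = -(k + 1 + 1 : ℤ) by omega,
      show n = -(k + 1 : ℤ) by omega]
    simp only [lucasUZ_neg]
    linarith
  · have := lucasUZ_neg A 1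
    simp only [lucasUZ_one] at this
    simp [this]
  · obtain ⟨k, hk⟩ := Int.eq_ofNat_of_zero_le (show 0 ≤ n - 1 by omega)
    obtain rfl : n = k + 1 := by omega
    simpa using key k

theorem eq_of_lucas_recurrence {A : ℤ} {f g : ℤ → ℤ}
    (hf : ∀ n, f (n + 1) = A * f n - f (n - 1)) (hg : ∀ n, g (n + 1) = A * g n - g (n - 1))
    (h0 : f 0 = g 0) (h1 : f 1 = g 1) (n : ℤ) : f n = g n := by
  suffices f n = g n ∧ f (n + 1) = g (n + 1) from this.1
  induction n using Int.induction_on with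
  | zero => simpa using ⟨h0, h1⟩
  | succ k ih =>
    refine ⟨ih.2, ?_⟩
    rw [hf, hg, ih.2, add_sub_cancel_right, ih.1]
  | pred k ih =>
    have hf' := hf (-k)
    have hg' := hg (-k)
    rw [sub_add_cancel]
    refine ⟨?_, ih.1⟩
    rw [ih.1, ih.2] at hf'
    linarith

theorem lucasUZ_two_left (n : ℤ) : lucasUZ 2 n = n :=
  eq_of_lucas_recurrence (A := 2) (g := fun n => n) (lucasUZ_succ 2) (fun _ => by ring)
    (by simp) (by simp) n

theorem lucasUZ_add (A m n : ℤ) :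
    lucasUZ A (m + n) = lucasUZ A m * lucasUZ A (n + 1) - lucasUZ A (m - 1) * lucasUZ A n := by
  refine eq_of_lucas_recurrence (A := A) (f := fun n => lucasUZ A (m + n))
    (g := fun n => lucasUZ A m * lucasUZ A (n + 1) - lucasUZ A (m - 1) * lucasUZ A n)
    (fun n => ?_) (fun n => ?_) ?_ ?_ n
  · have := lucasUZ_succ A (m + n)
    rwa [add_assoc, add_sub_assoc] at this
  · have h1 := lucasUZ_succ A (n + 1)
    have h2 := lucasUZ_succ A n
    simp only [add_sub_cancel_right, sub_add_cancel] at h1 ⊢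
    linear_combination lucasUZ A m * h1 - lucasUZ A (m - 1) * h2
  · simp
  · have h1 := lucasUZ_succ A m
    have h2 := lucasUZ_succ A 1
    simp only [sub_self, lucasUZ_zero, lucasUZ_one] at h2 ⊢
    rw [h1, h2]
    ring

theorem lucasUZ_norm (A n : ℤ) :
    lucasUZ A (n + 1) ^ 2 - A * lucasUZ A (n + 1) * lucasUZ A n + lucasUZ A n ^ 2 = 1 := by
  induction n using Int.induction_on with
  | zero => simp
  | succ k ih =>
    have := lucasUZ_succ A (k + 1)
    rw [add_sub_cancel_right] at this
    rw [this]
    linear_combination ih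
  | pred k ih =>
    have := lucasUZ_succ A (-k)
    rw [this] at ih
    rw [sub_add_cancel]
    linear_combination ih

theorem isCoprime_lucasUZ_succ (A n : ℤ) : IsCoprime (lucasUZ A n) (lucasUZ A (n + 1)) :=
  ⟨lucasUZ A n - A * lucasUZ A (n + 1), lucasUZ A (n + 1), by
    linear_combination lucasUZ_norm A n⟩

/-- The companion sequence `v_n(A, 1)`. -/
def lucasVZ (A n : ℤ) : ℤ := lucasUZ A (n + 1) - lucasUZ A (n - 1)

theorem lucasVZ_sq (A n : ℤ) : lucasVZ A n ^ 2 = (A ^ 2 - 4) * lucasUZ A n ^ 2 + 4 := by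
  have h := lucasUZ_succ A n
  have h' := lucasUZ_norm A n
  rw [lucasVZ, show lucasUZ A (n - 1) = A * lucasUZ A n - lucasUZ A (n + 1) by linarith]
  linear_combination 4 * h'

theorem lucasUZ_add_add_lucasUZ_sub (A k j : ℤ) :
    lucasUZ A (j + k) + lucasUZ A (j - k) = lucasUZ A j * lucasVZ A k := by
  have h1 := lucasUZ_add A j k
  have h2 := lucasUZ_add A j (-k)
  have h3 := lucasUZ_succ A k
  rw [show -k + 1 = -(k - 1) by ring, lucasUZ_neg, lucasUZ_neg, ← sub_eq_add_neg] at h2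
  rw [h1, h2, lucasVZ]
  ring

theorem sub_dvd_lucasUZ_sub (A A' n : ℤ) : A - A' ∣ lucasUZ A n - lucasUZ A' n := by
  suffices (A - A' ∣ lucasUZ A n - lucasUZ A' n) ∧
    (A - A' ∣ lucasUZ A (n + 1) - lucasUZ A' (n + 1)) from this.1
  induction n using Int.induction_on with
  | zero => simp
  | succ k ih =>
    refine ⟨ih.2, ?_⟩
    rw [lucasUZ_succ, lucasUZ_succ A', add_sub_cancel_right]
    obtain ⟨⟨a, ha⟩, b, hb⟩ := ih
    exact ⟨lucasUZ A (k + 1) + A' * b - a, by linear_combination A' * hb - ha⟩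
  | pred k ih =>
    have h1 := lucasUZ_succ A (-k)
    have h2 := lucasUZ_succ A' (-k)
    rw [sub_add_cancel]
    refine ⟨?_, ih.1⟩
    obtain ⟨⟨a, ha⟩, b, hb⟩ := ih
    exact ⟨lucasUZ A (-k) + A' * a - b, by linear_combination A' * ha - hb + h1 - h2⟩

theorem sub_two_dvd_lucasUZ_sub (A n : ℤ) : A - 2 ∣ lucasUZ A n - n := by
  simpa [lucasUZ_two_left] using sub_dvd_lucasUZ_sub A 2 n

theorem lucasUZ_neg_left (A n : ℤ) :
    lucasUZ (-A) n = lucasUZ A n ∨ lucasUZ (-A) n = -lucasUZ A n := by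
  suffices lucasUZ (-A) n = lucasUZ A n ∧ lucasUZ (-A) (n + 1) = -lucasUZ A (n + 1) ∨
      lucasUZ (-A) n = -lucasUZ A n ∧ lucasUZ (-A) (n + 1) = lucasUZ A (n + 1) by tauto
  induction n using Int.induction_on with
  | zero => simp
  | succ k ih =>
    have h1 := lucasUZ_succ A (k + 1)
    have h2 := lucasUZ_succ (-A) (k + 1)
    rw [add_sub_cancel_right] at h1 h2
    rcases ih with ⟨ih1, ih2⟩ | ⟨ih1, ih2⟩
    · exact Or.inr ⟨ih2, by rw [h1, h2, ih1, ih2]; ring⟩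
    · exact Or.inl ⟨ih2, by rw [h1, h2, ih1, ih2]; ring⟩
  | pred k ih =>
    have h1 := lucasUZ_succ A (-k)
    have h2 := lucasUZ_succ (-A) (-k)
    rw [sub_add_cancel]
    rcases ih with ⟨ih1, ih2⟩ | ⟨ih1, ih2⟩
    · rw [ih1, ih2] at h2
      exact Or.inr ⟨by linarith, ih1⟩
    · rw [ih1, ih2] at h2
      exact Or.inl ⟨by linarith, ih1⟩

/-! ### Growth -/

theorem abs_lucasUZ_abs (A n : ℤ) : |lucasUZ A (|n|)| = |lucasUZ A n| := by
  rcases abs_choice n with h | h <;> simp [h, lucasUZ_neg]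

theorem abs_lucasUZ_lt_succ {A : ℤ} (hA : 2 ≤ |A|) (n : ℕ) :
    |lucasUZ A n| < |lucasUZ A (n + 1)| := by
  induction n with
  | zero => simp
  | succ k ih =>
    have h := lucasUZ_succ A (k + 1)
    rw [add_sub_cancel_right] at h
    push_cast
    rw [h]
    have h1 := abs_sub_abs_le_abs_sub (A * lucasUZ A (k + 1)) (lucasUZ A k)
    rw [abs_mul] at h1
    nlinarith [abs_nonneg (lucasUZ A (k + 1))]

theorem strictMono_abs_lucasUZ {A : ℤ} (hA : 2 ≤ |A|) :
    StrictMono fun n : ℕ => |lucasUZ A n| :=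
  strictMono_nat_of_lt_succ fun n => by simpa using abs_lucasUZ_lt_succ hA n

theorem abs_lucasUZ_le_iff {A : ℤ} (hA : 2 ≤ |A|) {m n : ℤ} :
    |lucasUZ A m| ≤ |lucasUZ A n| ↔ |m| ≤ |n| := by
  have := (strictMono_abs_lucasUZ hA).le_iff_le (a := m.natAbs) (b := n.natAbs)
  rw [Int.natCast_natAbs, Int.natCast_natAbs, abs_lucasUZ_abs, abs_lucasUZ_abs] at this
  rw [this, Int.abs_eq_natAbs, Int.abs_eq_natAbs, Nat.cast_le]

theorem abs_eq_of_abs_lucasUZ_eq {A : ℤ} (hA : 2 ≤ |A|) {m n : ℤ}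
    (h : |lucasUZ A m| = |lucasUZ A n|) : |m| = |n| :=
  le_antisymm ((abs_lucasUZ_le_iff hA).1 h.le) ((abs_lucasUZ_le_iff hA).1 h.ge)

theorem lucasUZ_eq_zero_iff {A : ℤ} (hA : 2 ≤ |A|) {n : ℤ} : lucasUZ A n = 0 ↔ n = 0 := by
  refine ⟨fun h => ?_, fun h => by simp [h]⟩
  simpa using abs_eq_of_abs_lucasUZ_eq hA (m := n) (n := 0) (by simp [h])

theorem abs_le_abs_lucasUZ {A : ℤ} (hA : 2 ≤ |A|) (n : ℤ) : |n| ≤ |lucasUZ A n| := by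
  have key (k : ℕ) : (k : ℤ) ≤ |lucasUZ A k| := by
    induction k with
    | zero => simp
    | succ k ih =>
      have := abs_lucasUZ_lt_succ hA k
      push_cast
      omega
  have := key n.natAbs
  rwa [Int.natCast_natAbs, abs_lucasUZ_abs] at this

theorem abs_left_le_abs_lucasUZ {A n : ℤ} (hA : 2 ≤ |A|) (hn : 2 ≤ |n|) : |A| ≤ |lucasUZ A n| := by
  have h2 : lucasUZ A 2 = A := by simpa using lucasUZ_succ A 1
  simpa [h2] using (abs_lucasUZ_le_iff hA (m := 2) (n := n)).2 (by simpa using hn)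

/-! ### Divisibility -/

theorem lucasUZ_dvd_lucasUZ_mul_natCast (A n : ℤ) (q : ℕ) :
    lucasUZ A n ∣ lucasUZ A (n * q) := by
  induction q with
  | zero => simp
  | succ q ih =>
    have := lucasUZ_add A (n * q) n
    push_cast
    rw [mul_add, mul_one, this]
    exact dvd_sub (ih.mul_right _) (dvd_mul_left _ _)

theorem lucasUZ_dvd_of_dvd (A : ℤ) {n k : ℤ} (h : n ∣ k) : lucasUZ A n ∣ lucasUZ A k := by
  obtain ⟨q, rfl⟩ := h
  obtain ⟨q, rfl | rfl⟩ := q.eq_nat_or_neg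
  · exact lucasUZ_dvd_lucasUZ_mul_natCast A n q
  · rw [mul_neg, lucasUZ_neg, dvd_neg]
    exact lucasUZ_dvd_lucasUZ_mul_natCast A n q

theorem dvd_of_lucasUZ_dvd {A : ℤ} (hA : 2 ≤ |A|) {n k : ℤ} (hn : n ≠ 0)
    (h : lucasUZ A n ∣ lucasUZ A k) : n ∣ k := by
  have hk := lucasUZ_add A (n * (k / n)) (k % n)
  rw [Int.mul_ediv_add_emod] at hk
  have h1 : lucasUZ A n ∣ lucasUZ A (n * (k / n)) := lucasUZ_dvd_of_dvd A (dvd_mul_right _ _)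
  have h2 : lucasUZ A n ∣ lucasUZ A (n * (k / n) - 1) * lucasUZ A (k % n) := by
    have := dvd_sub (h1.mul_right (lucasUZ A (k % n + 1))) h
    rwa [hk, sub_sub_cancel] at this
  have hco : IsCoprime (lucasUZ A n) (lucasUZ A (n * (k / n) - 1)) := by
    have := (isCoprime_lucasUZ_succ A (n * (k / n) - 1)).symm
    rw [sub_add_cancel] at this
    exact this.of_isCoprime_of_dvd_left h1
  have h3 := hco.dvd_of_dvd_mul_left h2
  refine Int.dvd_of_emod_eq_zero ((lucasUZ_eq_zero_iff hA).1 ?_)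
  by_contra hr
  have h4 := (abs_lucasUZ_le_iff hA).1 (Int.le_of_dvd (abs_pos.2 hr) ((abs_dvd_abs _ _).2 h3))
  have h5 := Int.emod_lt_abs k hn
  rw [abs_of_nonneg (Int.emod_nonneg k hn)] at h4
  omega

theorem lucasUZ_mul_succ_congr (A n : ℤ) (q : ℕ) :
    lucasUZ A n ^ 2 ∣ lucasUZ A (n * (q + 1)) - (q + 1) * lucasUZ A n * lucasUZ A (n + 1) ^ q ∧
      lucasUZ A n ∣ lucasUZ A (n * (q + 1) + 1) - lucasUZ A (n + 1) ^ (q + 1) := by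
  induction q with
  | zero => simp
  | succ q ih =>
    have h1 := lucasUZ_add A n (n * (q + 1))
    have h2 := lucasUZ_add A (n + 1) (n * (q + 1))
    have h3 : lucasUZ A n ∣ lucasUZ A (n * (q + 1)) := lucasUZ_dvd_of_dvd A (dvd_mul_right _ _)
    have h4 := lucasUZ_succ A n
    obtain ⟨⟨a, ha⟩, b, hb⟩ := ih
    obtain ⟨c, hc⟩ := h3
    rw [add_sub_cancel_right] at h2
    push_cast
    rw [show n * ((q : ℤ) + 1 + 1) = n + n * (q + 1) by ring,
      show n + n * ((q : ℤ) + 1) + 1 = n + 1 + n * (q + 1) by ring]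
    refine ⟨⟨b - A * c + lucasUZ A (n + 1) * a, ?_⟩,
      ⟨lucasUZ A (n + 1) * b - lucasUZ A (n * (q + 1)), ?_⟩⟩
    · rw [h1, show lucasUZ A (n - 1) = A * lucasUZ A n - lucasUZ A (n + 1) by linarith]
      linear_combination lucasUZ A n * hb + lucasUZ A (n + 1) * ha - A * lucasUZ A n * hc
    · rw [h2]
      linear_combination lucasUZ A (n + 1) * hb

theorem lucasUZ_dvd_of_sq_dvd {A : ℤ} (hA : 2 ≤ |A|) {n k : ℤ} (hn : n ≠ 0)
    (h : lucasUZ A n ^ 2 ∣ lucasUZ A k) : lucasUZ A n ∣ k := by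
  have hu : lucasUZ A n ≠ 0 := mt (lucasUZ_eq_zero_iff hA).1 hn
  have key (q : ℕ) (hq : lucasUZ A n ^ 2 ∣ lucasUZ A (n * q)) : lucasUZ A n ∣ q := by
    cases q with
    | zero => simp
    | succ q =>
      push_cast at hq ⊢
      have h1 := dvd_sub hq (lucasUZ_mul_succ_congr A n q).1
      rw [sub_sub_cancel, mul_right_comm, sq] at h1
      exact (isCoprime_lucasUZ_succ A n).pow_right.dvd_of_dvd_mul_right
        (Int.dvd_of_mul_dvd_mul_right hu h1)
  obtain ⟨q, rfl⟩ := dvd_of_lucasUZ_dvd hA hn ((dvd_pow_self _ two_ne_zero).trans h)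
  refine Dvd.dvd.mul_left ?_ n
  obtain ⟨q, rfl | rfl⟩ := q.eq_nat_or_neg
  · exact key q h
  · rw [mul_neg, lucasUZ_neg, dvd_neg] at h
    exact (dvd_neg).2 (key q h)

/-! ### Pell equations -/

theorem exists_eq_lucasU_of_norm_eq_one {A : ℤ} (hA : 3 ≤ A) (z : ℕ) :
    ∀ y : ℤ, z ≤ y → y ^ 2 - A * y * z + (z : ℤ) ^ 2 = 1 →
      ∃ n : ℕ, y = lucasU A (n + 1) ∧ z = lucasU A n := by
  induction z using Nat.strong_induction_on with
  | _ z ih =>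
    intro y hzy h
    rcases Nat.eq_zero_or_pos z with rfl | hz
    · refine ⟨0, ?_, by simp [lucasU]⟩
      simp only [Nat.cast_zero] at hzy h
      simp only [lucasU]
      nlinarith
    · have hz' : (1 : ℤ) ≤ z := by exact_mod_cast hz
      have h0 : 0 ≤ A * z - y := by
        by_contra hlt
        nlinarith
      have hlt : A * z - y < z := by
        by_contra hle
        nlinarith
      obtain ⟨w, hw⟩ := Int.eq_ofNat_of_zero_le h0
      obtain ⟨n, h1, h2⟩ := ih w (by omega) z (by omega) (by
        rw [← hw]
        linear_combination h)
      refine ⟨n + 1, ?_, h1⟩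
      rw [lucasU, ← h1, ← h2]
      linarith

theorem exists_eq_lucasUZ_of_sq {A : ℤ} (hA : 3 ≤ |A|) {X Y : ℤ}
    (h : (A ^ 2 - 4) * Y ^ 2 + 4 = X ^ 2) : ∃ n : ℤ, Y = lucasUZ A n := by
  have pos {A : ℤ} (hA : 3 ≤ A) {X Y : ℤ} (hX : 0 ≤ X) (hY : 0 < Y)
      (h : (A ^ 2 - 4) * Y ^ 2 + 4 = X ^ 2) : ∃ n : ℤ, Y = lucasUZ A n := by
    have hpar : (2 : ℤ) ∣ A * Y - X := by
      have : Even ((A * Y - X) * (A * Y + X)) := ⟨2 * Y ^ 2 - 2, by linear_combination h⟩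
      rw [← even_iff_two_dvd]
      rcases Int.even_mul.1 this with h' | h'
      · exact h'
      · have := h'.sub (even_two_mul X)
        rwa [show A * Y + X - 2 * X = A * Y - X by ring] at this
    obtain ⟨z, hz⟩ := hpar
    have h0 : X ≤ A * Y := abs_le_of_sq_le_sq' (by nlinarith) (by positivity) |>.2
    have h1 : (A - 2) * Y < X := by
      by_contra hle
      have := pow_le_pow_left₀ hX (not_lt.1 hle) 2
      nlinarith [mul_pos (show 0 < A - 2 by omega) (pow_pos hY 2)]
    obtain ⟨w, rfl⟩ := Int.eq_ofNat_of_zero_le (show 0 ≤ z by omega)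
    obtain ⟨n, hn, -⟩ := exists_eq_lucasU_of_norm_eq_one hA w Y (by linarith) (by
      have : (w : ℤ) * 2 = A * Y - X := by linarith
      nlinarith)
    exact ⟨(n + 1 : ℕ), by rw [hn, lucasUZ_natCast]⟩
  have of_three_le {A : ℤ} (hA : 3 ≤ A) {Y : ℤ}
      (h : (A ^ 2 - 4) * Y ^ 2 + 4 = X ^ 2) : ∃ n : ℤ, Y = lucasUZ A n := by
    rcases lt_trichotomy Y 0 with hY | rfl | hY
    · obtain ⟨n, hn⟩ := pos hA (abs_nonneg X) (neg_pos.2 hY) (by rwa [neg_sq, sq_abs])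
      exact ⟨-n, by rw [lucasUZ_neg, ← hn, neg_neg]⟩
    · exact ⟨0, by simp⟩
    · exact pos hA (abs_nonneg X) hY (by rwa [sq_abs])
  rcases abs_choice A with hA' | hA'
  · exact of_three_le (hA' ▸ hA) h
  · obtain ⟨n, hn⟩ := of_three_le (A := -A) (Y := Y) (hA' ▸ hA) (by rwa [neg_sq])
    rcases lucasUZ_neg_left A n with h' | h'
    · exact ⟨n, hn.trans h'⟩
    · exact ⟨-n, by rw [hn, h', lucasUZ_neg]⟩

/-! ### Congruences modulo the companion sequence -/

theorem lucasVZ_dvd_lucasUZ_add_two_mul (A k j : ℤ) :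
    lucasVZ A k ∣ lucasUZ A (j + 2 * k) + lucasUZ A j := by
  have := lucasUZ_add_add_lucasUZ_sub A k (j + k)
  rw [add_sub_cancel_right, add_assoc, ← two_mul] at this
  exact this ▸ dvd_mul_left _ _

theorem lucasVZ_dvd_lucasUZ_add_mul (A k j q : ℤ) :
    lucasVZ A k ∣ lucasUZ A (j + 2 * k * q) - lucasUZ A j ∨
      lucasVZ A k ∣ lucasUZ A (j + 2 * k * q) + lucasUZ A j := by
  induction q using Int.induction_on with
  | zero => simp
  | succ q ih =>
    have h := lucasVZ_dvd_lucasUZ_add_two_mul A k (j + 2 * k * q)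
    rw [show j + 2 * k * q + 2 * k = j + 2 * k * (q + 1) by ring] at h
    rcases ih with ih | ih
    · exact Or.inr ((dvd_sub h ih).trans (dvd_of_eq (by ring)))
    · exact Or.inl ((dvd_sub h ih).trans (dvd_of_eq (by ring)))
  | pred q ih =>
    have h := lucasVZ_dvd_lucasUZ_add_two_mul A k (j + 2 * k * (-q - 1))
    rw [show j + 2 * k * (-q - 1) + 2 * k = j + 2 * k * (-q : ℤ) by ring] at h
    rcases ih with ih | ih
    · exact Or.inr ((dvd_sub h ih).trans (dvd_of_eq (by ring)))
    · exact Or.inl ((dvd_sub h ih).trans (dvd_of_eq (by ring)))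

theorem exists_abs_le_eq_add_two_mul {k : ℤ} (hk : k ≠ 0) (m : ℤ) :
    ∃ r q : ℤ, |r| ≤ |k| ∧ m = r + 2 * k * q := by
  have hk' : 0 < 2 * |k| := by positivity
  have h0 := Int.emod_nonneg (m + |k|) hk'.ne'
  have h1 := Int.emod_lt_of_pos (m + |k|) hk'
  have h2 := Int.emod_add_mul_ediv (m + |k|) (2 * |k|)
  refine ⟨(m + |k|) % (2 * |k|) - |k|, SignType.sign k * ((m + |k|) / (2 * |k|)),
    by rw [abs_le]; constructor <;> linarith, ?_⟩
  rw [show 2 * k * (SignType.sign k * ((m + |k|) / (2 * |k|))) =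
    2 * (k * SignType.sign k) * ((m + |k|) / (2 * |k|)) by ring, self_mul_sign]
  linarith

/-- If `V ∣ v_k` and `2 |u_k| < |V|`, then `u_m ≡ u_n (mod V)` forces `m ≡ ±n (mod 2k)`. -/
theorem two_mul_dvd_of_dvd_lucasUZ_sub {A k n m V : ℤ} (hA : 2 ≤ |A|) (hk : k ≠ 0)
    (hnk : |n| ≤ |k|) (hV : V ∣ lucasVZ A k) (hlt : 2 * |lucasUZ A k| < |V|)
    (h : V ∣ lucasUZ A m - lucasUZ A n) : 2 * k ∣ m - n ∨ 2 * k ∣ m + n := by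
  obtain ⟨r, q, hr, rfl⟩ := exists_abs_le_eq_add_two_mul hk m
  have hur := (abs_lucasUZ_le_iff hA).2 hr
  have hun := (abs_lucasUZ_le_iff hA).2 hnk
  have habs : |r| = |n| := by
    refine abs_eq_of_abs_lucasUZ_eq hA (abs_eq_abs.2 ?_)
    rcases lucasVZ_dvd_lucasUZ_add_mul A k r q with h' | h'
    · left
      have hd := dvd_sub h (hV.trans h')
      rw [sub_sub_sub_cancel_left] at hd
      refine sub_eq_zero.1 (Int.eq_zero_of_abs_lt_dvd ((abs_dvd _ _).2 hd) ?_)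
      exact (abs_sub _ _).trans_lt (by linarith)
    · right
      have hd := dvd_sub (hV.trans h') h
      rw [add_sub_sub_cancel] at hd
      refine eq_neg_of_add_eq_zero_left (Int.eq_zero_of_abs_lt_dvd ((abs_dvd _ _).2 hd) ?_)
      exact (abs_add_le _ _).trans_lt (by linarith)
  rcases abs_eq_abs.1 habs with rfl | rfl
  · left
    exact ⟨q, by ring⟩
  · right
    exact ⟨q, by ring⟩

/-! ### The factors of `DFI` -/

theorem exists_sq_of_isCoprime_of_pos {a b c : ℤ} (ha : 0 < a) (hab : IsCoprime a b)
    (h : a * b = c ^ 2) : ∃ d, a = d ^ 2 := by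
  obtain ⟨d, hd | hd⟩ := Int.sq_of_isCoprime hab h
  · exact ⟨d, hd⟩
  · nlinarith [sq_nonneg d]

theorem exists_sq_of_lucasUZ (G n : ℤ) :
    ∃ w, (G ^ 2 - 1) * lucasUZ (2 * G) n ^ 2 + 1 = w ^ 2 := by
  have h := lucasVZ_sq (2 * G) n
  have h2 : (2 : ℤ) ∣ lucasVZ (2 * G) n := Int.prime_two.dvd_of_dvd_pow (n := 2)
    ⟨2 * ((G ^ 2 - 1) * lucasUZ (2 * G) n ^ 2 + 1), by rw [h]; ring⟩
  obtain ⟨w, hw⟩ := h2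
  exact ⟨w, by rw [hw] at h; linarith⟩

theorem exists_eq_lucasUZ_of_sq_two_mul {G : ℤ} (hG : 2 ≤ |G|) {H w : ℤ}
    (h : (G ^ 2 - 1) * H ^ 2 + 1 = w ^ 2) : ∃ m, H = lucasUZ (2 * G) m :=
  exists_eq_lucasUZ_of_sq (A := 2 * G) (X := 2 * w)
    (by rw [abs_mul, abs_two]; omega) (by linear_combination 4 * h)

theorem not_isSquare_sq_sub_four {A : ℤ} (hA : 3 ≤ |A|) : ¬IsSquare (A ^ 2 - 4) := by
  rintro ⟨r, hr⟩
  have h2 : |r| < |A| := sq_lt_sq.1 (by linarith)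
  have h3 : r ^ 2 ≤ (|A| - 1) ^ 2 := by
    rw [← sq_abs r]
    exact pow_le_pow_left₀ (abs_nonneg r) (by omega) 2
  nlinarith [sq_abs A]

theorem exists_ne_zero_pell {A N : ℤ} (hA : 3 ≤ |A|) (hN : N ≠ 0) :
    ∃ x w : ℤ, x ≠ 0 ∧ 4 * (A ^ 2 - 4) * (N * x) ^ 2 + 1 = w ^ 2 := by
  have hpos : 0 < A ^ 2 - 4 := by nlinarith [sq_abs A]
  have hsq : ¬IsSquare ((A ^ 2 - 4) * (2 * N) ^ 2) := by
    rintro ⟨r, hr⟩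
    have h1 : (2 * N) ^ 2 ∣ r ^ 2 := ⟨A ^ 2 - 4, by linarith⟩
    obtain ⟨s, rfl⟩ := (Int.pow_dvd_pow_iff two_ne_zero).1 h1
    refine not_isSquare_sq_sub_four hA ⟨s, ?_⟩
    have : (2 * N) ^ 2 ≠ 0 := by positivity
    refine mul_right_cancel₀ this (hr.trans (by ring))
  obtain ⟨w, x, h, hx⟩ := Pell.exists_of_not_isSquare (by positivity) hsq
  exact ⟨x, w, hx, by linear_combination -h⟩

theorem exists_DFI_eq_sq {A B : ℤ} (hA : 3 ≤ |A|) (hB : B ≠ 0) :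
    ∃ x : ℤ, x ≠ 0 ∧ ∃ y m : ℤ, DFI A B (lucasUZ A B) x y = m ^ 2 := by
  set C := lucasUZ A B with hC
  have hC0 : C ≠ 0 := mt (lucasUZ_eq_zero_iff (by omega)).1 hB
  have hDv := lucasVZ_sq A B
  rw [← hC] at hDv
  obtain ⟨D, hD⟩ : ∃ D, D = (A ^ 2 - 4) * C ^ 2 + 4 := ⟨_, rfl⟩
  have hD0 : D ≠ 0 := by
    have hΔ : 0 < A ^ 2 - 4 := by nlinarith [sq_abs A]
    rw [hD]
    positivity
  obtain ⟨x, w, hx, hw⟩ := exists_ne_zero_pell (N := C ^ 2 * D) hA (by positivity)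
  obtain ⟨F, hF⟩ : ∃ F, F = 4 * (A ^ 2 - 4) * (C ^ 2 * D * x) ^ 2 + 1 := ⟨_, rfl⟩
  obtain ⟨G, hG⟩ : ∃ G, G = 1 + C * D * F - 2 * (A + 2) * (A - 2) ^ 2 * (C ^ 2 * D * x) ^ 2 :=
    ⟨_, rfl⟩
  have hH : F ∣ lucasUZ (2 * G) B - C := by
    refine Dvd.dvd.trans ?_ (sub_dvd_lucasUZ_sub (2 * G) A B)
    exact ⟨2 * C * D - (A - 2), by rw [hG]; linear_combination (A - 2) * hF⟩
  have hH' : 2 * C ∣ lucasUZ (2 * G) B - B := by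
    refine Dvd.dvd.trans ?_ (sub_two_dvd_lucasUZ_sub (2 * G) B)
    exact ⟨D * F - 2 * (A + 2) * (A - 2) ^ 2 * C ^ 3 * D ^ 2 * x ^ 2, by rw [hG]; ring⟩
  have hF1 : F = 1 + 2 * C * (2 * (A ^ 2 - 4) * C ^ 3 * D ^ 2 * x ^ 2) := by rw [hF]; ring
  have hco : IsCoprime (2 * C) F :=
    ⟨-(2 * (A ^ 2 - 4) * C ^ 3 * D ^ 2 * x ^ 2), 1, by linear_combination hF1⟩
  obtain ⟨y, hy⟩ : 2 * C * F ∣ lucasUZ (2 * G) B - (C + B * F - C * F) := by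
    refine hco.mul_dvd ?_ ?_
    · obtain ⟨a, ha⟩ := hH'
      exact ⟨a - (B - C) * (2 * (A ^ 2 - 4) * C ^ 3 * D ^ 2 * x ^ 2), by
        linear_combination ha - (B - C) * hF1⟩
    · obtain ⟨a, ha⟩ := hH
      exact ⟨a - B + C, by linear_combination ha⟩
  obtain ⟨z, hz⟩ := exists_sq_of_lucasUZ G B
  rw [show lucasUZ (2 * G) B = C + B * F + (2 * y - 1) * C * F by linear_combination hy] at hz
  refine ⟨x, hx, y, lucasVZ A B * w * z, ?_⟩
  simp only [DFI]
  rw [← hD, ← hF, ← hG, hz, hF, hw, hD, ← hDv]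
  ring

theorem exists_sq_of_DFI_eq_sq {A B C D E F G H x y m : ℤ} (hA : 3 ≤ |A|)
    (hD : D = (A ^ 2 - 4) * C ^ 2 + 4) (hE : E = C ^ 2 * D * x)
    (hF : F = 4 * (A ^ 2 - 4) * E ^ 2 + 1)
    (hG : G = 1 + C * D * F - 2 * (A + 2) * (A - 2) ^ 2 * E ^ 2)
    (hH : H = C + B * F + (2 * y - 1) * C * F)
    (hm : D * F * ((G ^ 2 - 1) * H ^ 2 + 1) = m ^ 2) :
    (∃ d, D = d ^ 2) ∧ (∃ f, F = f ^ 2) ∧ ∃ i, (G ^ 2 - 1) * H ^ 2 + 1 = i ^ 2 := by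
  have hΔ : 0 < A ^ 2 - 4 := by nlinarith [sq_abs A]
  have hD0 : 4 ≤ D := by rw [hD]; nlinarith [sq_nonneg C]
  have hF0 : 0 < F := by rw [hF]; positivity
  obtain ⟨g, hg⟩ : ∃ g, G = 1 + D * g :=
    ⟨C * F - 2 * (A + 2) * (A - 2) ^ 2 * C ^ 4 * D * x ^ 2, by rw [hG, hE]; ring⟩
  have hG0 : G ≠ 0 := by
    rintro rfl
    have := Int.le_of_dvd one_pos (⟨-g, by linarith⟩ : D ∣ 1)
    omega
  have hI0 : 0 < (G ^ 2 - 1) * H ^ 2 + 1 := by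
    have : 0 < G ^ 2 := by positivity
    have : 0 ≤ (G ^ 2 - 1) * H ^ 2 := mul_nonneg (by omega) (sq_nonneg H)
    omega
  have hDF : IsCoprime D F :=
    ⟨-(4 * (A ^ 2 - 4) * C ^ 4 * D * x ^ 2), 1, by rw [hF, hE]; ring⟩
  have hDI : IsCoprime D ((G ^ 2 - 1) * H ^ 2 + 1) :=
    ⟨-(g * (G + 1) * H ^ 2), 1, by linear_combination (G + 1) * H ^ 2 * hg⟩
  have hFI : IsCoprime F ((G ^ 2 - 1) * H ^ 2 + 1) := by
    have h1 : 2 * G - A = F * (2 * C * D - (A - 2)) := by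
      rw [hG]
      linear_combination (A - 2) * hF
    have h4 : 4 * ((G ^ 2 - 1) * H ^ 2 + 1) = D + F * ((2 * C * D - (A - 2)) * (2 * G + A) * H ^ 2
        + (A ^ 2 - 4) * (B + (2 * y - 1) * C) * (H + C)) := by
      linear_combination (2 * G + A) * H ^ 2 * h1 + (A ^ 2 - 4) * (H + C) * hH - hD
    refine IsCoprime.of_mul_right_right (y := 4) ?_
    rw [h4]
    exact hDF.symm.add_mul_left_right _
  refine ⟨exists_sq_of_isCoprime_of_pos (by omega) (hDF.mul_right hDI) (by rw [← hm]; ring),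
    exists_sq_of_isCoprime_of_pos hF0 (hDF.symm.mul_right hFI) (c := m) (by rw [← hm]; ring),
    exists_sq_of_isCoprime_of_pos hI0 (hDI.symm.mul_right hFI.symm) (c := m)
      (by rw [← hm]; ring)⟩

theorem two_le_abs_of_DFI {A C D E F G x : ℤ} (hA : 4 ≤ |A|) (hC : C ≠ 0) (hx : x ≠ 0)
    (hD : D = (A ^ 2 - 4) * C ^ 2 + 4) (hE : E = C ^ 2 * D * x)
    (hF : F = 4 * (A ^ 2 - 4) * E ^ 2 + 1)
    (hG : G = 1 + C * D * F - 2 * (A + 2) * (A - 2) ^ 2 * E ^ 2) : 2 ≤ |G| := by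
  have hΔ : 3 * |A| ≤ A ^ 2 - 4 := by nlinarith [sq_abs A]
  have hD0 : 4 ≤ D := by rw [hD]; nlinarith [sq_nonneg C]
  have hE0 : 0 < E ^ 2 := by rw [hE]; positivity
  obtain ⟨g, hg⟩ : ∃ g, G = 1 + D * g :=
    ⟨C * F - 2 * (A + 2) * (A - 2) ^ 2 * C ^ 4 * D * x ^ 2, by rw [hG, hE]; ring⟩
  by_contra! hlt
  rcases (by rw [abs_lt] at hlt; omega : G = -1 ∨ G = 0 ∨ G = 1) with h | h | h
  · have := Int.le_of_dvd two_pos (⟨-g, by linarith⟩ : D ∣ 2)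
    omega
  · have := Int.le_of_dvd one_pos (⟨-g, by linarith⟩ : D ∣ 1)
    omega
  · have h1 : F ∣ A - 2 := ⟨A - 2 - 2 * C * D, by
      rw [h] at hG
      linear_combination -(A - 2) * hF - 2 * hG⟩
    have h2 : A - 2 ≠ 0 := by
      rintro h2
      obtain rfl : A = 2 := by omega
      norm_num at hA
    have h3 := Int.le_of_dvd (abs_pos.2 h2) ((dvd_abs _ _).2 h1)
    have h4 := abs_sub A 2
    rw [abs_two] at h4
    nlinarith

theorem eq_lucasUZ_of_DFI_eq_sq {A B C x y m : ℤ} (hB : 1 < |B|) (hAB : 2 * |B| < |A| - 2)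
    (hdvd : A - 2 ∣ C - B) (hx : x ≠ 0) (hm : DFI A B C x y = m ^ 2) : C = lucasUZ A B := by
  have hA : 7 ≤ |A| := by omega
  have hA' : 2 ≤ |A| := by omega
  have hA2 : |A| - 2 ≤ |A - 2| := by simpa using abs_sub_abs_le_abs_sub A 2
  have hC : C ≠ 0 := by
    rintro rfl
    have h1 : |B| < |A - 2| := by omega
    have := Int.eq_zero_of_abs_lt_dvd ((abs_dvd _ _).2 ((dvd_neg).1 (by simpa using hdvd))) h1
    simp [this] at hB
  obtain ⟨D, hD⟩ : ∃ D, D = (A ^ 2 - 4) * C ^ 2 + 4 := ⟨_, rfl⟩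
  obtain ⟨E, hE⟩ : ∃ E, E = C ^ 2 * D * x := ⟨_, rfl⟩
  obtain ⟨F, hF⟩ : ∃ F, F = 4 * (A ^ 2 - 4) * E ^ 2 + 1 := ⟨_, rfl⟩
  obtain ⟨G, hG⟩ : ∃ G, G = 1 + C * D * F - 2 * (A + 2) * (A - 2) ^ 2 * E ^ 2 := ⟨_, rfl⟩
  obtain ⟨H, hH⟩ : ∃ H, H = C + B * F + (2 * y - 1) * C * F := ⟨_, rfl⟩
  simp only [DFI] at hm
  rw [← hD, ← hE, ← hF, ← hG, ← hH] at hm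
  obtain ⟨⟨d, hd⟩, ⟨f, hf⟩, i, hi⟩ := exists_sq_of_DFI_eq_sq (by omega) hD hE hF hG hH hm
  have hΔ : 45 ≤ A ^ 2 - 4 := by nlinarith [sq_abs A]
  have hD0 : 4 ≤ D := by rw [hD]; nlinarith [sq_nonneg C]
  have hE0 : E ≠ 0 := by rw [hE]; positivity
  obtain ⟨n, hn⟩ := exists_eq_lucasUZ_of_sq (A := A) (by omega) (hD.symm.trans hd)
  obtain ⟨k, hk⟩ := exists_eq_lucasUZ_of_sq (A := A) (X := 2 * f) (Y := 4 * E) (by omega)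
    (by linear_combination 4 * hf - 4 * hF)
  obtain ⟨j, hj⟩ := exists_eq_lucasUZ_of_sq_two_mul
    (two_le_abs_of_DFI (by omega) hC hx hD hE hF hG) hi
  have hn0 : n ≠ 0 := by
    rintro rfl
    exact hC (by simpa using hn)
  have hk0 : k ≠ 0 := by
    rintro rfl
    exact hE0 (by simpa using hk)
  have hCk : C ^ 2 ∣ lucasUZ A k := hk ▸ ⟨4 * D * x, by rw [hE]; ring⟩
  have hCdvd : C ∣ k := by
    rw [hn] at hCk ⊢
    exact lucasUZ_dvd_of_sq_dvd hA' hn0 hCk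
  have hnk : |n| ≤ |k| := by
    rw [← abs_lucasUZ_le_iff hA', ← hn]
    exact Int.le_of_dvd (abs_pos.2 (mt (lucasUZ_eq_zero_iff hA').1 hk0))
      ((abs_dvd_abs _ _).2 ((dvd_pow_self C two_ne_zero).trans hCk))
  have hfF : f ∣ F := hf ▸ dvd_pow_self f two_ne_zero
  have hV : f ∣ lucasVZ A k := by
    have h1 := lucasVZ_sq A k
    rw [← hk] at h1
    exact (Int.pow_dvd_pow_iff two_ne_zero).1
      (⟨4, by linear_combination h1 + 4 * hf - 4 * hF⟩ : f ^ 2 ∣ lucasVZ A k ^ 2)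
  have hflt : 2 * |lucasUZ A k| < |f| := by
    rw [← abs_two, ← abs_mul, ← sq_lt_sq, ← hf, hF, ← hk]
    nlinarith [sq_nonneg E]
  have hcong : f ∣ lucasUZ A j - lucasUZ A n := by
    have h1 : F ∣ H - C := ⟨B + (2 * y - 1) * C, by rw [hH]; ring⟩
    have h2 : F ∣ lucasUZ (2 * G) j - lucasUZ A j :=
      Dvd.dvd.trans ⟨2 * C * D - (A - 2), by rw [hG]; linear_combination (A - 2) * hF⟩
        (sub_dvd_lucasUZ_sub (2 * G) A j)
    have h3 := dvd_sub h1 h2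
    rw [← hj, sub_sub_sub_cancel_left, hn] at h3
    exact hfF.trans h3
  have hjB : 2 * C ∣ j - B := by
    have h1 : 2 * C ∣ lucasUZ (2 * G) j - j :=
      Dvd.dvd.trans ⟨D * F - 2 * (A + 2) * (A - 2) ^ 2 * C ^ 3 * D ^ 2 * x ^ 2, by
        rw [hG, hE]; ring⟩ (sub_two_dvd_lucasUZ_sub (2 * G) j)
    have h2 : 2 * C ∣ H - B :=
      ⟨y + (B + (2 * y - 1) * C) * (2 * (A ^ 2 - 4) * C ^ 3 * D ^ 2 * x ^ 2), by
        rw [hH, hF, hE]; ring⟩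
    have h3 := dvd_sub h2 h1
    rwa [← hj, sub_sub_sub_cancel_left] at h3
  have hnB : 2 * C ∣ B - n ∨ 2 * C ∣ B + n := by
    have h2 : 2 * C ∣ 2 * k := mul_dvd_mul_left 2 hCdvd
    rcases two_mul_dvd_of_dvd_lucasUZ_sub hA' hk0 hnk hV hflt hcong with h | h
    · left
      simpa using dvd_sub (h2.trans h) hjB
    · right
      have := dvd_sub (h2.trans h) hjB
      rwa [show j + n - (j - B) = B + n by ring] at this
  have hn2 : 2 ≤ |n| := by
    by_contra! hlt
    have hlucas : C = n := by
      rcases (by rw [abs_lt] at hlt; omega : n = -1 ∨ n = 1) with rfl | rfl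
      · simpa [lucasUZ_neg] using hn
      · simpa using hn
    have h1 : |C - B| < |A - 2| := by
      have := abs_sub C B
      rw [hlucas] at this ⊢
      omega
    have h2 := Int.eq_zero_of_abs_lt_dvd ((abs_dvd _ _).2 hdvd) h1
    have h3 : C = B := by omega
    rw [← h3, hlucas] at hB
    omega
  have hCA : |A| ≤ |C| := hn ▸ abs_left_le_abs_lucasUZ hA' hn2
  have hnC : |n| ≤ |C| := hn ▸ abs_le_abs_lucasUZ hA' n
  have h2C : |2 * C| = 2 * |C| := by rw [abs_mul, abs_two]
  rcases hnB with h | h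
  · have h1 := Int.eq_zero_of_abs_lt_dvd ((abs_dvd _ _).2 h)
      (by have := abs_sub B n; omega)
    rwa [show B = n by omega]
  · have h1 := Int.eq_zero_of_abs_lt_dvd ((abs_dvd _ _).2 h)
      (by have := abs_add_le B n; omega)
    obtain rfl : n = -B := by omega
    rw [lucasUZ_neg] at hn
    have h2 := dvd_add hdvd (sub_two_dvd_lucasUZ_sub A B)
    rw [hn, show -lucasUZ A B - B + (lucasUZ A B - B) = -(2 * B) by ring, dvd_neg] at h2
    have h3 := Int.eq_zero_of_abs_lt_dvd ((abs_dvd _ _).2 h2)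
      (by rw [abs_mul, abs_two]; omega)
    obtain rfl : B = 0 := by omega
    simp at hB

theorem stmt13 (A B C : ℤ) (hB : 1 < |B|) (hAB : 2 * |B| < |A| - 2) :
    C = lucasUZ A B ↔
      (A - 2 ∣ C - B) ∧ ∃ x : ℤ, x ≠ 0 ∧ ∃ y m : ℤ, DFI A B C x y = m ^ 2 := by
  constructor
  · rintro rfl
    refine ⟨sub_two_dvd_lucasUZ_sub A B, exists_DFI_eq_sq (by omega) ?_⟩
    rintro rfl
    simp at hB
  · rintro ⟨hdvd, x, hx, y, m, hm⟩
    exact eq_lucasUZ_of_DFI_eq_sq hB hAB hdvd hx hm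
end

section
/- Let A, B, U, V ∈ ℤ with B > 0. Then (UV)^{B−1}·u_B(A, 1) ≡ Σ_{r=0}^{B−1} U^{2r}·V^{2(B−1−r)} (mod U² − A·U·V + V²). -/
theorem geom_sum_sq_add_two (U V : ℤ) (n : ℕ) :
    ∑ r ∈ Finset.range (n + 2), U ^ (2 * r) * V ^ (2 * (n + 2 - 1 - r)) =
      (U ^ 2 + V ^ 2) * ∑ r ∈ Finset.range (n + 1), U ^ (2 * r) * V ^ (2 * (n + 1 - 1 - r)) -
        (U * V) ^ 2 * ∑ r ∈ Finset.range n, U ^ (2 * r) * V ^ (2 * (n - 1 - r)) := by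
  have succ_right (m : ℕ) :
      ∑ r ∈ Finset.range (m + 1), U ^ (2 * r) * V ^ (2 * (m + 1 - 1 - r)) =
        U ^ (2 * m) + V ^ 2 * ∑ r ∈ Finset.range m, U ^ (2 * r) * V ^ (2 * (m - 1 - r)) := by
    simp only [pow_mul]
    exact geom_sum₂_succ_eq (U ^ 2) (V ^ 2)
  rw [succ_right (n + 1), succ_right n]
  ring

theorem mul_pow_mul_lucasU_modEq (A U V : ℤ) : ∀ n : ℕ,
    (U * V) ^ (n - 1) * lucasU A n ≡
      (∑ r ∈ Finset.range n, U ^ (2 * r) * V ^ (2 * (n - 1 - r)))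
        [ZMOD (U ^ 2 - A * U * V + V ^ 2)]
  | 0 => by simp [lucasU, Int.ModEq.refl]
  | 1 => by simp [lucasU, Int.ModEq.refl]
  | n + 2 => by
    have h_sum : U ^ 2 + V ^ 2 ≡ A * (U * V) [ZMOD (U ^ 2 - A * U * V + V ^ 2)] :=
      (Int.modEq_iff_dvd.2 ⟨1, by ring⟩ : A * (U * V) ≡ U ^ 2 + V ^ 2 [ZMOD _]).symm
    have h_rec : (U * V) ^ (n + 2 - 1) * lucasU A (n + 2) =
        A * (U * V) * ((U * V) ^ (n + 1 - 1) * lucasU A (n + 1)) -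
          (U * V) ^ 2 * ((U * V) ^ (n - 1) * lucasU A n) := by
      cases n with
      | zero => simp [lucasU]; ring
      | succ k => simp only [lucasU, Nat.add_sub_cancel, Nat.add_succ_sub_one]; ring
    rw [h_rec, geom_sum_sq_add_two]
    exact (h_sum.symm.mul (mul_pow_mul_lucasU_modEq A U V (n + 1))).sub
      ((mul_pow_mul_lucasU_modEq A U V n).mul_left _)

theorem stmt14 (A B U V : ℤ) (hB : 0 < B) :
    (U * V) ^ (B.toNat - 1) * lucasUZ A B ≡
      (∑ r ∈ Finset.range B.toNat, U ^ (2 * r) * V ^ (2 * (B.toNat - 1 - r)))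
        [ZMOD (U ^ 2 - A * U * V + V ^ 2)] := by
  simpa [lucasUZ, hB.le] using mul_pow_mul_lucasU_modEq A U V B.toNat
end

section
/- Let B, V, W be integers with B > 0 and |V| > 1. Then W = V^B if and only if there exist A, C ∈ ℤ such that |A| ≥ max{V^{4B}, W⁴}, C = u_B(A, 1), and (V² − 1)·W·C ≡ V·(W² − 1) (mod A·V − V² − 1). -/
/-- Modulo `A * V - V ^ 2 - 1` the characteristic roots of `u_n(A, 1)` are `V` and `V⁻¹`. -/
theorem dvd_lucasU_mul_pow_sub (A V : ℤ) (n : ℕ) :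
    (A * V - V ^ 2 - 1) ∣ (V ^ 2 - 1) * V ^ n * lucasU A n - V * ((V ^ n) ^ 2 - 1) := by
  induction n using Nat.twoStepInduction with
  | zero => simp [lucasU]
  | one => exact ⟨0, by simp only [lucasU]; ring⟩
  | more n ih₀ ih₁ =>
    obtain ⟨x, hx⟩ := ih₀
    obtain ⟨y, hy⟩ := ih₁
    refine ⟨A * V * y - V ^ 2 * x + V * ((V ^ (n + 1)) ^ 2 - 1), ?_⟩
    simp only [lucasU]
    linear_combination A * V * hy - V ^ 2 * hx

theorem isCoprime_mul_sub_sq_sub_one (A V : ℤ) : IsCoprime (A * V - V ^ 2 - 1) V :=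
  ⟨-1, A - V, by ring⟩

theorem mul_add_one_mul_sub_lt {v p w a : ℤ} (hv : 2 ≤ v) (hvp : v ≤ p) (hw : 0 ≤ w)
    (hpa : p ^ 4 ≤ a) (hwa : w ^ 4 ≤ a) : (p * w + 1) * (p + w) < a * v - v ^ 2 - 1 := by
  obtain ⟨m, hpm, hwm, hma⟩ : ∃ m, p ≤ m ∧ w ≤ m ∧ m ^ 4 ≤ a := by
    rcases le_total p w with h | h
    · exact ⟨w, h, le_rfl, hwa⟩
    · exact ⟨p, le_rfl, h, hpa⟩
  have hm : 2 ≤ m := by lia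
  have hp : 0 ≤ p := by lia
  have upper : (p * w + 1) * (p + w) ≤ (m * m + 1) * (m + m) := by gcongr
  have hm2 : 4 ≤ m ^ 2 := by nlinarith
  have hm3 : 2 * m ^ 2 ≤ m ^ 3 := by nlinarith
  have hm4 : 2 * m ^ 3 ≤ m ^ 4 := by nlinarith
  have lower : 2 * m ^ 4 - 5 ≤ a * v - v ^ 2 - 1 := by
    have : 0 ≤ (v - 2) * (a - v - 2) := mul_nonneg (by lia) (by nlinarith)
    nlinarith
  nlinarith

theorem stmt15 (B V W : ℤ) (hB : 0 < B) (hV : 1 < |V|) :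
    W = V ^ B.toNat ↔
      ∃ A C : ℤ, max (V ^ (4 * B.toNat)) (W ^ 4) ≤ |A| ∧ C = lucasUZ A B ∧
        (A * V - V ^ 2 - 1) ∣ ((V ^ 2 - 1) * W * C - V * (W ^ 2 - 1)) := by
  have hC (A : ℤ) : lucasUZ A B = lucasU A B.toNat := if_pos hB.le
  have hn : B.toNat ≠ 0 := by lia
  simp only [hC]
  generalize B.toNat = n at hn ⊢
  constructor
  · rintro rfl
    refine ⟨V ^ (4 * n), _, max_le (le_abs_self _) ?_, rfl, dvd_lucasU_mul_pow_sub _ _ _⟩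
    rw [← pow_mul, mul_comm n 4]
    exact le_abs_self _
  · rintro ⟨A, C, hA, rfl, hdvd⟩
    obtain ⟨hPA, hWA⟩ := max_le_iff.1 hA
    have hP := dvd_lucasU_mul_pow_sub A V n
    have hVP : |V| ≤ |V ^ n| := by
      rw [abs_pow]
      exact le_self_pow₀ hV.le hn
    rw [mul_comm 4 n, pow_mul] at hPA
    generalize V ^ n = P at *
    have key : (A * V - V ^ 2 - 1) ∣ (P * W + 1) * (P - W) := by
      refine (isCoprime_mul_sub_sq_sub_one A V).dvd_of_dvd_mul_left ?_
      convert dvd_sub (hdvd.mul_left P) (hP.mul_left W) using 1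
      ring
    have h4 (x : ℤ) : |x| ^ 4 = x ^ 4 := Even.pow_abs (by decide) x
    have hlt := mul_add_one_mul_sub_lt (v := |V|) (p := |P|) (w := |W|) (a := |A|)
      hV hVP (abs_nonneg W) (by rwa [h4]) (by rwa [h4])
    have hupper : |(P * W + 1) * (P - W)| ≤ (|P| * |W| + 1) * (|P| + |W|) := by
      rw [abs_mul]
      gcongr
      · simpa [abs_mul] using abs_add_le (P * W) 1
      · exact abs_sub P W
    have hlower : |A| * |V| - |V| ^ 2 - 1 ≤ |A * V - V ^ 2 - 1| := by
      have h := abs_sub_abs_le_abs_sub (A * V) (V ^ 2 + 1)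
      rw [abs_mul, abs_of_pos (by positivity : 0 < V ^ 2 + 1)] at h
      rw [sq_abs, sub_sub, sub_sub]
      exact h
    have hzero := Int.eq_zero_of_abs_lt_dvd ((abs_dvd _ _).2 key)
      (hupper.trans_lt (hlt.trans_le hlower))
    rcases mul_eq_zero.1 hzero with h | h
    · have hunit : IsUnit P := IsUnit.of_mul_eq_one (-W) (by linear_combination -h)
      have := Int.isUnit_iff_abs_eq.1 hunit
      lia
    · exact (sub_eq_zero.1 h).symm
end

section
/- Let m ∈ ℤ. Then m ≥ 0 if and only if there exists a nonzero integer x such that (3m − 1)x² + 1 is a perfect square, i.e., (3m − 1)x² + 1 ∈ □. -/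
/-- An integer congruent to `2` modulo `3` is not a perfect square. -/
theorem not_isSquare_three_mul_sub_one (m : ℤ) : ¬ IsSquare (3 * m - 1) := by
  rintro ⟨r, hr⟩
  have hmod : r * r % 3 = 2 := by omega
  have h : r % 3 = 0 ∨ r % 3 = 1 ∨ r % 3 = 2 := by omega
  rcases h with h | h | h <;> simp [Int.mul_emod, h] at hmod

theorem stmt18 (m : ℤ) :
    0 ≤ m ↔ ∃ x : ℤ, x ≠ 0 ∧ ∃ y : ℤ, (3 * m - 1) * x ^ 2 + 1 = y ^ 2 := by
  constructor
  · intro hm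
    obtain rfl | hpos := hm.eq_or_lt
    · exact ⟨1, one_ne_zero, 0, by norm_num⟩
    · obtain ⟨y, x, hxy, hx⟩ :=
        Pell.exists_of_not_isSquare (d := 3 * m - 1) (by omega) (not_isSquare_three_mul_sub_one m)
      exact ⟨x, hx, y, by linarith⟩
  · rintro ⟨x, hx, y, hxy⟩
    by_contra! hm
    have hx_sq : 0 < x ^ 2 := by positivity
    nlinarith [sq_nonneg y]
end
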